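/- Let H be a crown-free linear 3-graph and let e = {a,b,c} be an edge of H with d(a) = d(b) = d(c) = 4. Then for any two distinct vertices x, y ∈ {a,b,c} and any edge g ≠ e of H with y ∈ g, there exists an edge f ≠ e of H with x ∈ f such that (f \ {x}) ∩ (g \ {y}) ≠ ∅. -/

import Mathlib

/-- `E` is (the edge set of) a linear 3-graph: every edge has 3 vertices and
any two distinct edges intersect in at most one vertex. -/
def LinearTripleSystem {V : Type*} [DecidableEq V] (E : Finset (Finset V)) : Prop :=
  (∀ e ∈ E, e.card = 3) ∧ ∀ e ∈ E, ∀ f ∈ E, e ≠ f → (e ∩ f).card ≤ 1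

/-- `E` contains a crown: three pairwise disjoint edges (jewels) together with a
base edge intersecting all three jewels. -/
def HasCrown {V : Type*} [DecidableEq V] (E : Finset (Finset V)) : Prop :=
  ∃ base ∈ E, ∃ j1 ∈ E, ∃ j2 ∈ E, ∃ j3 ∈ E,
    Disjoint j1 j2 ∧ Disjoint j1 j3 ∧ Disjoint j2 j3 ∧
    (base ∩ j1).Nonempty ∧ (base ∩ j2).Nonempty ∧ (base ∩ j3).Nonempty

/-- The degree of a vertex: the number of edges containing it. -/
def degree {V : Type*} [DecidableEq V] (E : Finset (Finset V)) (v : V) : ℕ :=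
  (E.filter (fun e => v ∈ e)).card

theorem LinearTripleSystem.eq_of_mem {V : Type*} [DecidableEq V] {E : Finset (Finset V)}
    (hlin : LinearTripleSystem E) {e f : Finset V} (he : e ∈ E) (hf : f ∈ E) {x y : V}
    (hxy : x ≠ y) (hxe : x ∈ e) (hye : y ∈ e) (hxf : x ∈ f) (hyf : y ∈ f) : e = f := by
  by_contra h
  exact hxy (Finset.card_le_one.mp (hlin.2 e he f hf h) x (Finset.mem_inter.mpr ⟨hxe, hxf⟩)
    y (Finset.mem_inter.mpr ⟨hye, hyf⟩))

/-- If `S` has fewer elements than there are edges other than `e` through `x`, then one of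
these edges avoids `S` outside `x`. -/
theorem LinearTripleSystem.exists_disjoint_sdiff {V : Type*} [DecidableEq V]
    {E : Finset (Finset V)} (hlin : LinearTripleSystem E) (e : Finset V) (x : V)
    (S : Finset V) (hS : S.card + 1 < degree E x) :
    ∃ f ∈ E, f ≠ e ∧ x ∈ f ∧ Disjoint (f \ {x}) S := by
  by_contra! h
  have hmeet : ∀ f ∈ (E.filter (fun e => x ∈ e)).erase e, ∃ v ∈ S, v ∈ f ∧ v ≠ x := by
    intro f hf
    simp only [Finset.mem_erase, Finset.mem_filter] at hf
    obtain ⟨v, hv, hvS⟩ := Finset.not_disjoint_iff.mp (h f hf.2.1 hf.1 hf.2.2)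
    simp only [Finset.mem_sdiff, Finset.mem_singleton] at hv
    exact ⟨v, hvS, hv⟩
  have : Nonempty V := ⟨x⟩
  choose! φ hφS hφ using hmeet
  have hcard : S.card < ((E.filter (fun e => x ∈ e)).erase e).card := by
    have := Finset.pred_card_le_card_erase (s := E.filter (fun e => x ∈ e)) (a := e)
    unfold degree at hS
    omega
  obtain ⟨f, hf, f', hf', hne, heq⟩ :=
    Finset.exists_ne_map_eq_of_card_lt_of_maps_to hcard (fun f hf => hφS f hf)
  obtain ⟨h₁, h₂⟩ := hφ f hf
  have h₃ := (hφ f' hf').1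
  rw [← heq] at h₃
  simp only [Finset.mem_erase, Finset.mem_filter] at hf hf'
  exact hne (hlin.eq_of_mem hf.2.1 hf'.2.1 h₂ h₁ hf.2.2 h₃ hf'.2.2)

theorem LinearTripleSystem.disjoint_of_disjoint_sdiff {V : Type*} [DecidableEq V]
    {E : Finset (Finset V)} (hlin : LinearTripleSystem E) {e f g : Finset V} (he : e ∈ E)
    (hf : f ∈ E) (hg : g ∈ E) (hfe : f ≠ e) (hge : g ≠ e) {x y : V} (hxy : x ≠ y)
    (hxe : x ∈ e) (hye : y ∈ e) (hxf : x ∈ f) (hyg : y ∈ g)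
    (h : Disjoint (f \ {x}) (g \ {y})) : Disjoint f g := by
  rw [Finset.disjoint_left] at h ⊢
  intro v hvf hvg
  have hvx : v ≠ x := by
    rintro rfl
    exact hge (hlin.eq_of_mem hg he hxy hvg hyg hxe hye)
  have hvy : v ≠ y := by
    rintro rfl
    exact hfe (hlin.eq_of_mem hf he hxy hxf hvf hxe hye)
  exact @h v (by simp [hvf, hvx]) (by simp [hvg, hvy])

theorem LinearTripleSystem.exists_inter_sdiff_nonempty {V : Type*} [DecidableEq V]
    {E : Finset (Finset V)} (hlin : LinearTripleSystem E) (hcf : ¬ HasCrown E)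
    {e : Finset V} (he : e ∈ E) {x y z : V} (hxy : x ≠ y) (hxz : x ≠ z) (hyz : y ≠ z)
    (hxe : x ∈ e) (hye : y ∈ e) (hze : z ∈ e) (hdx : 4 ≤ degree E x) (hdz : 4 ≤ degree E z)
    {g : Finset V} (hg : g ∈ E) (hge : g ≠ e) (hyg : y ∈ g) :
    ∃ f ∈ E, f ≠ e ∧ x ∈ f ∧ ((f \ {x}) ∩ (g \ {y})).Nonempty := by
  by_contra! hno
  have hcard : ∀ f ∈ E, ∀ v ∈ f, (f \ {v}).card = 2 := by
    intro f hf v hv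
    rw [Finset.sdiff_singleton_eq_erase, Finset.card_erase_of_mem hv, hlin.1 f hf]
  obtain ⟨r, hr, hre, hzr, hrg⟩ := hlin.exists_disjoint_sdiff e z (g \ {y})
    (by rw [hcard g hg y hyg]; omega)
  obtain ⟨p, hp, hpe, hxp, hpr⟩ := hlin.exists_disjoint_sdiff e x (r \ {z})
    (by rw [hcard r hr z hzr]; omega)
  have hpg : Disjoint (p \ {x}) (g \ {y}) :=
    Finset.disjoint_iff_inter_eq_empty.mpr (hno p hp hpe hxp)
  exact hcf ⟨e, he, p, hp, g, hg, r, hr,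
    hlin.disjoint_of_disjoint_sdiff he hp hg hpe hge hxy hxe hye hxp hyg hpg,
    hlin.disjoint_of_disjoint_sdiff he hp hr hpe hre hxz hxe hze hxp hzr hpr,
    hlin.disjoint_of_disjoint_sdiff he hg hr hge hre hyz hye hze hyg hzr hrg.symm,
    ⟨x, Finset.mem_inter.mpr ⟨hxe, hxp⟩⟩, ⟨y, Finset.mem_inter.mpr ⟨hye, hyg⟩⟩,
    ⟨z, Finset.mem_inter.mpr ⟨hze, hzr⟩⟩⟩

/-- In a crown-free linear 3-graph with an edge `e = {a,b,c}` all of whose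
vertices have degree 4: for any two distinct `x, y ∈ {a,b,c}` and any edge
`g ≠ e` containing `y`, there is an edge `f ≠ e` containing `x` with
`(f \ {x}) ∩ (g \ {y}) ≠ ∅`. -/
theorem matchings_intersect {V : Type*} [DecidableEq V] (E : Finset (Finset V))
    (hlin : LinearTripleSystem E) (hcf : ¬ HasCrown E)
    (a b c : V) (hab : a ≠ b) (hac : a ≠ c) (hbc : b ≠ c)
    (he : ({a, b, c} : Finset V) ∈ E)
    (hda : degree E a = 4) (hdb : degree E b = 4) (hdc : degree E c = 4) :
    ∀ x ∈ ({a, b, c} : Finset V), ∀ y ∈ ({a, b, c} : Finset V), x ≠ y →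
      ∀ g ∈ E, g ≠ ({a, b, c} : Finset V) → y ∈ g →
        ∃ f ∈ E, f ≠ ({a, b, c} : Finset V) ∧ x ∈ f ∧
          ((f \ {x}) ∩ (g \ {y})).Nonempty := by
  intro x hx y hy hxy g hg hge hyg
  have hdeg : ∀ v ∈ ({a, b, c} : Finset V), 4 ≤ degree E v := by
    simp [hda, hdb, hdc]
  obtain ⟨z, hz, hzx, hzy⟩ : ∃ z ∈ ({a, b, c} : Finset V), z ≠ x ∧ z ≠ y := by
    have hlt : ({x, y} : Finset V).card < ({a, b, c} : Finset V).card :=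
      Finset.card_le_two.trans_lt (by rw [hlin.1 _ he]; norm_num)
    simpa using Finset.exists_mem_notMem_of_card_lt_card hlt
  exact hlin.exists_inter_sdiff_nonempty hcf he hxy hzx.symm hzy.symm hx hy hz
    (hdeg x hx) (hdeg z hz) hg hge hyg
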